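/- arXiv:1707.06321 — 2 statements merged into one kernel-verified Lean document; each statement's English description precedes it below -/
import Mathlib

section
/- Let α : I → ℝ³ be a unit-speed admissible curve in the pseudo-isotropic space Iₚ³ with causal sign ε, η = −ε, Frenet frame {t, n, b}, curvature κ, and torsion τ, and fix s₀ ∈ I. If n₁ is a vector field along α with ⟨n₁, t⟩_{z,p} = 0, ⟨n₁, n₁⟩_{z,p} = η, det(t, n₁, b) = det(t, n, b), and n₁ rotation minimizing, then there is a constant τ₀ with n₁(s) = n(s) − (∫_{s₀}^{s} τ(x) dx + τ₀) b for all s; moreover, the resulting RM frame {t, n₁, n₂ = b} satisfies t′ = η κ₁ n₁ + κ₂ n₂, n₁′ = −ε κ₁ t, n₂′ = 0, where κ₁ = κ and κ₂ = η κ θ with θ(s) = ∫_{s₀}^{s} τ(x) dx + τ₀. -/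
noncomputable section

abbrev V3 : Type := ℝ × ℝ × ℝ

/-- The pseudo-isotropic inner product ⟨u,v⟩_{z,p} = u₁v₁ - u₂v₂. -/
def innerZP (u v : V3) : ℝ := u.1 * v.1 - u.2.1 * v.2.1

/-- The Lorentz-Minkowski inner product ⟨u,v⟩₁ = u₁v₁ - u₂v₂ + u₃v₃. -/
def dot1 (u v : V3) : ℝ := u.1 * v.1 - u.2.1 * v.2.1 + u.2.2 * v.2.2

/-- Determinant of the three vectors u, v, w taken as rows. -/
def det3 (u v w : V3) : ℝ :=
    u.1 * (v.2.1 * w.2.2 - v.2.2 * w.2.1)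
  - u.2.1 * (v.1 * w.2.2 - v.2.2 * w.1)
  + u.2.2 * (v.1 * w.2.1 - v.2.1 * w.1)

/-- The Lorentzian cross product u ×₁ v = (u₂v₃ - u₃v₂, u₁v₃ - u₃v₁, u₁v₂ - u₂v₁). -/
def cross1 (u v : V3) : V3 :=
  (u.2.1 * v.2.2 - u.2.2 * v.2.1, u.1 * v.2.2 - u.2.2 * v.1, u.1 * v.2.1 - u.2.1 * v.1)

/-- The top view ũ = (u₁, u₂, 0) of a vector u. -/
def tildeV (u : V3) : V3 := (u.1, u.2.1, (0 : ℝ))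

/-- The derivative of a curve in `V3` is computed coordinatewise. -/
lemma hasDerivAt_triple {x y z : ℝ → ℝ} {s : ℝ} (hx : DifferentiableAt ℝ x s)
    (hy : DifferentiableAt ℝ y s) (hz : DifferentiableAt ℝ z s) :
    HasDerivAt (fun s => ((x s, y s, z s) : V3)) (deriv x s, deriv y s, deriv z s) s :=
  hx.hasDerivAt.prodMk (hy.hasDerivAt.prodMk hz.hasDerivAt)

/-- The coordinates of a differentiable curve in `V3` have the coordinates of its derivative as
derivatives. -/
lemma hasDerivAt_coordinates {v : ℝ → V3} {v' : V3} {s : ℝ} (hv : HasDerivAt v v' s) :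
    HasDerivAt (fun s => (v s).1) v'.1 s ∧ HasDerivAt (fun s => (v s).2.1) v'.2.1 s ∧
      HasDerivAt (fun s => (v s).2.2) v'.2.2 s := by
  have hfst : HasDerivAt (fun s => (v s).1) v'.1 s := by
    simpa using (HasFDerivAt.fst hv.hasFDerivAt).hasDerivAt
  have hsnd : HasDerivAt (fun s => (v s).2) v'.2 s := by
    simpa using (HasFDerivAt.snd hv.hasFDerivAt).hasDerivAt
  exact ⟨hfst, by simpa using (HasFDerivAt.fst hsnd.hasFDerivAt).hasDerivAt,
    by simpa using (HasFDerivAt.snd hsnd.hasFDerivAt).hasDerivAt⟩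

/-- A planar vector that is Lorentz-orthogonal and parallel to a non-null vector vanishes. -/
lemma eq_zero_of_orthogonal_of_parallel {X Y p q ε : ℝ} (hε : ε ≠ 0) (hXY : X ^ 2 - Y ^ 2 = ε)
    (horth : p * X - q * Y = 0) (hpar : X * q - Y * p = 0) : p = 0 ∧ q = 0 := by
  constructor
  · refine (mul_eq_zero.1 ?_).resolve_left hε
    linear_combination (-p) * hXY + X * horth + Y * hpar
  · refine (mul_eq_zero.1 ?_).resolve_left hε
    linear_combination (-q) * hXY + Y * horth + X * hpar

/-- If `X ^ 2 - Y ^ 2` is constant on an open set, then `X` times its derivative equals `Y` times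
its derivative there. -/
lemma deriv_mul_eq_of_sq_sub_sq_const {X Y : ℝ → ℝ} {I : Set ℝ} {s ε : ℝ} (hI : IsOpen I)
    (hs : s ∈ I) (hX : DifferentiableAt ℝ X s) (hY : DifferentiableAt ℝ Y s)
    (hunit : ∀ s ∈ I, X s ^ 2 - Y s ^ 2 = ε) : X s * deriv X s - Y s * deriv Y s = 0 := by
  have hderiv := (hX.hasDerivAt.pow 2).sub (hY.hasDerivAt.pow 2)
  have hconst : HasDerivAt (X ^ 2 - Y ^ 2) 0 s :=
    (hasDerivAt_const s ε).congr_of_eventuallyEq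
      (Filter.eventually_of_mem (hI.mem_nhds hs) hunit)
  have := hderiv.unique hconst
  norm_num at this
  linarith

/-- A rotation minimizing unit normal field n₁ along a unit-speed admissible curve in Iₚ³
equals n - (∫ τ + τ₀) b, and the resulting RM frame {t, n₁, n₂ = b} satisfies
t' = ηκ₁ n₁ + κ₂ n₂, n₁' = -εκ₁ t, n₂' = 0, where κ₁ = κ and κ₂ = ηκθ. -/
theorem stmt_15
    (I : Set ℝ) (hI : ∃ a b : ℝ, I = Set.Ioo a b)
    (ε η : ℝ) (hε : ε = 1 ∨ ε = -1) (hη : η = -ε)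
    (α : ℝ → V3) (hα : ContDiff ℝ (⊤ : ℕ∞) α)
    (x y z : ℝ → ℝ) (hcomp : ∀ s, α s = (x s, y s, z s))
    (hunit : ∀ s ∈ I, (deriv x s) ^ 2 - (deriv y s) ^ 2 = ε)
    (hadm : ∀ s ∈ I, deriv x s * deriv (deriv y) s - deriv (deriv x) s * deriv y s ≠ 0)
    (κ : ℝ → ℝ)
    (hκdef : ∀ s, κ s = -ε * (deriv x s * deriv (deriv y) s - deriv (deriv x) s * deriv y s))
    (t : ℝ → V3) (ht : ∀ s, t s = deriv α s)
    (b : V3) (hb : b = ((0 : ℝ), (0 : ℝ), (1 : ℝ)))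
    (n : ℝ → V3) (hn : ∀ s, n s = (η * κ s)⁻¹ • deriv t s)
    (τ : ℝ → ℝ) (hτ : ∀ s ∈ I, deriv n s = (-ε * κ s) • t s + τ s • b)
    (hτc : Continuous τ)
    (s₀ : ℝ) (hs₀ : s₀ ∈ I)
    (n₁ : ℝ → V3) (hn₁d : ∀ s ∈ I, DifferentiableAt ℝ n₁ s)
    (hn₁t : ∀ s ∈ I, innerZP (n₁ s) (t s) = 0)
    (hn₁n₁ : ∀ s ∈ I, innerZP (n₁ s) (n₁ s) = η)
    (hdet : ∀ s ∈ I, det3 (t s) (n₁ s) b = det3 (t s) (n s) b)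
    (hRM : ∀ s ∈ I, ∃ μ : ℝ, deriv n₁ s = μ • t s)
    :
    ∃ τ₀ : ℝ, ∀ s ∈ I,
      n₁ s = n s - ((∫ u in s₀..s, τ u) + τ₀) • b ∧
      deriv t s = (η * κ s) • n₁ s + (η * κ s * ((∫ u in s₀..s, τ u) + τ₀)) • b ∧
      deriv n₁ s = (-ε * κ s) • t s ∧
      deriv (fun _ : ℝ => b) s = (0 : V3) := by
  have hIo : IsOpen I := by
    obtain ⟨c, d, rfl⟩ := hI
    exact isOpen_Ioo
  have hIc : IsPreconnected I := by
    obtain ⟨c, d, rfl⟩ := hI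
    exact isPreconnected_Ioo
  have hε0 : ε ≠ 0 := by rcases hε with h | h <;> rw [h] <;> norm_num
  have hη0 : η ≠ 0 := by rw [hη]; exact neg_ne_zero.2 hε0
  have hα' : α = fun s => (x s, y s, z s) := funext hcomp
  have hxs : ContDiff ℝ (⊤ : ℕ∞) x := by simpa [hα'] using hα.fst
  have hys : ContDiff ℝ (⊤ : ℕ∞) y := by simpa [hα'] using hα.snd.fst
  have hzs : ContDiff ℝ (⊤ : ℕ∞) z := by simpa [hα'] using hα.snd.snd
  have smooth_deriv : ∀ {f : ℝ → ℝ}, ContDiff ℝ (⊤ : ℕ∞) f → ContDiff ℝ (⊤ : ℕ∞) (deriv f) :=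
    fun hf => (contDiff_infty_iff_deriv.1 hf).2
  have smooth_diff : ∀ {f : ℝ → ℝ}, ContDiff ℝ (⊤ : ℕ∞) f → Differentiable ℝ f :=
    fun hf => (contDiff_infty_iff_deriv.1 hf).1
  have hx1 := smooth_deriv hxs
  have hy1 := smooth_deriv hys
  have hz1 := smooth_deriv hzs
  have hx2 := smooth_diff (smooth_deriv hx1)
  have hy2 := smooth_diff (smooth_deriv hy1)
  have hz2 := smooth_diff (smooth_deriv hz1)
  have htc : t = fun s => (deriv x s, deriv y s, deriv z s) := by
    funext s
    rw [ht, hα']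
    exact (hasDerivAt_triple (smooth_diff hxs s) (smooth_diff hys s) (smooth_diff hzs s)).deriv
  have htd : deriv t = fun s =>
      (deriv (deriv x) s, deriv (deriv y) s, deriv (deriv z) s) := by
    funext s
    rw [htc]
    exact (hasDerivAt_triple (smooth_diff hx1 s) (smooth_diff hy1 s) (smooth_diff hz1 s)).deriv
  have hκ0 : ∀ s ∈ I, η * κ s ≠ 0 := fun s hs => by
    rw [hκdef]
    exact mul_ne_zero hη0 (mul_ne_zero (neg_ne_zero.2 hε0) (hadm s hs))
  have hκd : Differentiable ℝ κ := by
    rw [funext hκdef]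
    have := smooth_diff hx1
    have := smooth_diff hy1
    fun_prop
  have hnd : ∀ s ∈ I, DifferentiableAt ℝ n s := fun s hs => by
    rw [funext hn, htd]
    exact (((hκd s).const_mul η).inv (hκ0 s hs)).smul
      ((hx2 s).prodMk ((hy2 s).prodMk (hz2 s)))
  have htop : ∀ s ∈ I, (n₁ s).1 - (n s).1 = 0 ∧ (n₁ s).2.1 - (n s).2.1 = 0 := fun s hs => by
    have hnt : deriv x s * (n s).1 - deriv y s * (n s).2.1 = 0 := by
      have := deriv_mul_eq_of_sq_sub_sq_const hIo hs (smooth_diff hx1 s) (smooth_diff hy1 s) hunit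
      rw [hn, htd]
      simp only [Prod.smul_mk, smul_eq_mul]
      linear_combination (η * κ s)⁻¹ * this
    have hd := hdet s hs
    have ho := hn₁t s hs
    simp only [det3, innerZP, hb, htc] at hd ho
    exact eq_zero_of_orthogonal_of_parallel hε0 (hunit s hs)
      (by linear_combination ho - hnt) (by linear_combination hd)
  have hn₁' : ∀ s ∈ I, deriv n₁ s = (-ε * κ s) • t s ∧
      HasDerivAt (fun s => (n₁ s).2.2 - (n s).2.2) (-τ s) s := fun s hs => by
    obtain ⟨μ, hμ⟩ := hRM s hs
    obtain ⟨hd1, hd2, hthird⟩ :=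
      hasDerivAt_coordinates ((hn₁d s hs).hasDerivAt.sub (hnd s hs).hasDerivAt)
    have hfst : (deriv n₁ s - deriv n s).1 = 0 := hd1.unique
      ((hasDerivAt_const s (0 : ℝ)).congr_of_eventuallyEq
        (Filter.eventually_of_mem (hIo.mem_nhds hs) fun u hu => (htop u hu).1))
    have hsnd : (deriv n₁ s - deriv n s).2.1 = 0 := hd2.unique
      ((hasDerivAt_const s (0 : ℝ)).congr_of_eventuallyEq
        (Filter.eventually_of_mem (hIo.mem_nhds hs) fun u hu => (htop u hu).2))
    rw [hμ, hτ s hs, hb, htc] at hfst hsnd hthird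
    simp at hfst hsnd
    have hμκ : μ = -ε * κ s := by
      have : ε * (μ - -ε * κ s) = 0 := by
        linear_combination (-(μ - -ε * κ s)) * hunit s hs + deriv x s * hfst - deriv y s * hsnd
      exact sub_eq_zero.1 ((mul_eq_zero.1 this).resolve_left hε0)
    refine ⟨by rw [hμ, hμκ], hthird.congr_deriv ?_⟩
    simp [hμκ]
  have hint : ∀ s, HasDerivAt (fun s => ∫ u in s₀..s, τ u) (τ s) s := fun s =>
    intervalIntegral.integral_hasDerivAt_right (hτc.intervalIntegrable _ _)
      (hτc.stronglyMeasurableAtFilter _ _) hτc.continuousAt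
  have hsum : ∀ s ∈ I, HasDerivAt
      (fun s => ((n₁ s).2.2 - (n s).2.2) + ∫ u in s₀..s, τ u) 0 s := fun s hs =>
    ((hn₁' s hs).2.add (hint s)).congr_deriv (neg_add_cancel _)
  obtain ⟨c, hc⟩ := hIo.exists_is_const_of_deriv_eq_zero hIc
    (fun s hs => (hsum s hs).differentiableAt.differentiableWithinAt)
    (fun s hs => (hsum s hs).deriv)
  refine ⟨-c, fun s hs => ?_⟩
  have hn₁n : n₁ s = n s - ((∫ u in s₀..s, τ u) + -c) • b := by
    have := hc s hs
    obtain ⟨h1, h2⟩ := htop s hs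
    rw [hb]
    refine Prod.ext ?_ (Prod.ext ?_ ?_) <;> simp <;> linarith
  refine ⟨hn₁n, ?_, (hn₁' s hs).1, deriv_const s b⟩
  have htn : deriv t s = (η * κ s) • n s := by rw [hn, smul_inv_smul₀ (hκ0 s hs)]
  rw [hn₁n, htn, smul_sub, smul_smul, sub_add_cancel]
end
end

section
/- Let α : I → ℝ³ be a C⁴ unit-speed admissible curve in the pseudo-isotropic space Iₚ³ with RM frame {t, n₁, n₂ = b} and natural curvatures κ₁, κ₂. Then α lies on a pseudo-isotropic sphere—i.e., there exist c₁, c₂, c₃, c₄ ∈ ℝ such that x(s)² − y(s)² + 2c₁x(s) + 2c₂y(s) + 2c₃z(s) + c₄ = 0 for all s ∈ I—if and only if the normal development (κ₁(s), κ₂(s)) lies on a line not passing through the origin, i.e., there exist constants a₁, a₂ ∈ ℝ with a₁κ₁(s) + a₂κ₂(s) = 1 for all s ∈ I. -/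
noncomputable section

theorem exists_eq_const_of_hasDerivAt_zero {a b : ℝ} {f : ℝ → ℝ}
    (hf : ∀ s ∈ Set.Ioo a b, HasDerivAt f 0 s) : ∃ c, ∀ s ∈ Set.Ioo a b, f s = c :=
  isOpen_Ioo.exists_is_const_of_deriv_eq_zero isPreconnected_Ioo
    (fun s hs => (hf s hs).differentiableAt.differentiableWithinAt) fun s hs => (hf s hs).deriv

/-- On an open set, two derivatives of functions agreeing on the set agree. -/
theorem HasDerivAt.unique_of_eqOn {U : Set ℝ} (hU : IsOpen U) {f g : ℝ → ℝ} (h : Set.EqOn f g U)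
    {s f' g' : ℝ} (hs : s ∈ U) (hf : HasDerivAt f f' s) (hg : HasDerivAt g g' s) : f' = g' :=
  hf.unique (hg.congr_of_eventuallyEq (h.eventuallyEq_of_mem (hU.mem_nhds hs)))

/-- Membership in a pseudo-isotropic sphere in terms of the natural equations of the moving frame
`(x', y', z')`, `(ε y', ε x', w)`, `(0, 0, 1)`. -/
theorem sphere_iff_line_of_natural_equations {a b ε : ℝ} (hε : ε ^ 2 = 1)
    {x y z x' y' z' w κ₁ κ₂ : ℝ → ℝ}
    (hx : ∀ s ∈ Set.Ioo a b, HasDerivAt x (x' s) s)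
    (hy : ∀ s ∈ Set.Ioo a b, HasDerivAt y (y' s) s)
    (hz : ∀ s ∈ Set.Ioo a b, HasDerivAt z (z' s) s)
    (hunit : ∀ s ∈ Set.Ioo a b, x' s ^ 2 - y' s ^ 2 = ε)
    (hx' : ∀ s ∈ Set.Ioo a b, HasDerivAt x' (-κ₁ s * y' s) s)
    (hy' : ∀ s ∈ Set.Ioo a b, HasDerivAt y' (-κ₁ s * x' s) s)
    (hz' : ∀ s ∈ Set.Ioo a b, HasDerivAt z' (-ε * κ₁ s * w s + κ₂ s) s)
    (hw : ∀ s ∈ Set.Ioo a b, HasDerivAt w (-ε * κ₁ s * z' s) s) :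
    (∃ c₁ c₂ c₃ c₄ : ℝ, ∀ s ∈ Set.Ioo a b,
        x s ^ 2 - y s ^ 2 + 2 * c₁ * x s + 2 * c₂ * y s + 2 * c₃ * z s + c₄ = 0) ↔
      (∃ a₁ a₂ : ℝ, ∀ s ∈ Set.Ioo a b, a₁ * κ₁ s + a₂ * κ₂ s = 1) := by
  constructor
  · rintro ⟨c₁, c₂, c₃, c₄, hF⟩
    have htangent : ∀ s ∈ Set.Ioo a b,
        (x s + c₁) * x' s - (y s - c₂) * y' s + c₃ * z' s = 0 := fun s hs => by
      have hd := (((((hx s hs).pow 2).sub ((hy s hs).pow 2)).add ((hx s hs).const_mul (2 * c₁))).add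
        ((hy s hs).const_mul (2 * c₂))).add ((hz s hs).const_mul (2 * c₃)) |>.add_const c₄
      have h0 := HasDerivAt.unique_of_eqOn isOpen_Ioo (fun r hr => hF r hr) hs hd
        (hasDerivAt_const s (0 : ℝ))
      norm_num at h0
      linear_combination h0 / 2
    obtain ⟨g, hg⟩ := exists_eq_const_of_hasDerivAt_zero
      (f := fun s => (x s + c₁) * y' s - (y s - c₂) * x' s + ε * c₃ * w s) fun s hs => by
        refine (((((hx s hs).add_const c₁).mul (hy' s hs)).sub
          (((hy s hs).sub_const c₂).mul (hx' s hs))).add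
          ((hw s hs).const_mul (ε * c₃))).congr_deriv ?_
        linear_combination -κ₁ s * htangent s hs - c₃ * κ₁ s * z' s * hε
    refine ⟨ε * g, -ε * c₃, fun s hs => ?_⟩
    have h2 := HasDerivAt.unique_of_eqOn isOpen_Ioo (fun r hr => htangent r hr) hs
      (((((hx s hs).add_const c₁).mul (hx' s hs)).sub
        (((hy s hs).sub_const c₂).mul (hy' s hs))).add ((hz' s hs).const_mul c₃))
      (hasDerivAt_const s (0 : ℝ))
    linear_combination -ε * h2 - ε * κ₁ s * hg s hs + ε * hunit s hs + hε
  · rintro ⟨a₁, a₂, hline⟩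
    have hA : ∀ s ∈ Set.Ioo a b,
        HasDerivAt (fun s => ε * a₁ + a₂ * w s) (-κ₁ s * (ε * a₂ * z' s)) s := fun s hs =>
      (((hw s hs).const_mul a₂).const_add (ε * a₁)).congr_deriv (by ring)
    have hB : ∀ s ∈ Set.Ioo a b,
        HasDerivAt (fun s => ε * a₂ * z' s) (ε - κ₁ s * (ε * a₁ + a₂ * w s)) s := fun s hs =>
      ((hz' s hs).const_mul (ε * a₂)).congr_deriv
        (by linear_combination ε * hline s hs - a₂ * κ₁ s * w s * hε)
    obtain ⟨c₁, hc₁⟩ := exists_eq_const_of_hasDerivAt_zero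
      (f := fun s => ε * (ε * a₂ * z' s * x' s - (ε * a₁ + a₂ * w s) * y' s) - x s) fun s hs => by
        refine (((((hB s hs).mul (hx' s hs)).sub ((hA s hs).mul (hy' s hs))).const_mul ε).sub
          (hx s hs)).congr_deriv ?_
        linear_combination x' s * hε
    obtain ⟨c₂, hc₂⟩ := exists_eq_const_of_hasDerivAt_zero
      (f := fun s => y s - ε * (ε * a₂ * z' s * y' s - (ε * a₁ + a₂ * w s) * x' s)) fun s hs => by
        refine ((hy s hs).sub ((((hB s hs).mul (hy' s hs)).sub
          ((hA s hs).mul (hx' s hs))).const_mul ε)).congr_deriv ?_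
        linear_combination -y' s * hε
    obtain ⟨c₄, hc₄⟩ := exists_eq_const_of_hasDerivAt_zero
      (f := fun s => x s ^ 2 - y s ^ 2 + 2 * c₁ * x s + 2 * c₂ * y s + 2 * (-ε * a₂) * z s)
      fun s hs => by
        refine ((((((hx s hs).pow 2).sub ((hy s hs).pow 2)).add
          ((hx s hs).const_mul (2 * c₁))).add ((hy s hs).const_mul (2 * c₂))).add
          ((hz s hs).const_mul (2 * (-ε * a₂)))).congr_deriv ?_
        norm_num
        linear_combination -2 * x' s * hc₁ s hs - 2 * y' s * hc₂ s hs
          + 2 * ε ^ 2 * a₂ * z' s * hunit s hs + 2 * ε * a₂ * z' s * hε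
    exact ⟨c₁, c₂, -ε * a₂, -c₄, fun s hs => by linear_combination hc₄ s hs⟩

/-- A C⁴ unit-speed admissible curve in Iₚ³ lies on a pseudo-isotropic sphere iff its
normal development (κ₁, κ₂) lies on a line not passing through the origin. -/
theorem stmt_17
    (I : Set ℝ) (hI : ∃ a b : ℝ, I = Set.Ioo a b)
    (ε η : ℝ) (hε : ε = 1 ∨ ε = -1) (hη : η = -ε)
    (α : ℝ → V3) (hα : ContDiff ℝ 4 α)
    (x y z : ℝ → ℝ) (hcomp : ∀ s, α s = (x s, y s, z s))
    (hunit : ∀ s ∈ I, (deriv x s) ^ 2 - (deriv y s) ^ 2 = ε)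
    (hadm : ∀ s ∈ I, deriv x s * deriv (deriv y) s - deriv (deriv x) s * deriv y s ≠ 0)
    (κ : ℝ → ℝ)
    (hκdef : ∀ s, κ s = -ε * (deriv x s * deriv (deriv y) s - deriv (deriv x) s * deriv y s))
    (t : ℝ → V3) (ht : ∀ s, t s = deriv α s)
    (b : V3) (hb : b = ((0 : ℝ), (0 : ℝ), (1 : ℝ)))
    (n : ℝ → V3) (hn : ∀ s, n s = (η * κ s)⁻¹ • deriv t s)
    (τ : ℝ → ℝ) (hτ : ∀ s ∈ I, deriv n s = (-ε * κ s) • t s + τ s • b)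
    (n₁ : ℝ → V3) (hn₁d : ∀ s ∈ I, DifferentiableAt ℝ n₁ s)
    (hn₁t : ∀ s ∈ I, innerZP (n₁ s) (t s) = 0)
    (hn₁n₁ : ∀ s ∈ I, innerZP (n₁ s) (n₁ s) = η)
    (hdet : ∀ s ∈ I, det3 (t s) (n₁ s) b = det3 (t s) (n s) b)
    (hRM : ∀ s ∈ I, ∃ μ : ℝ, deriv n₁ s = μ • t s)
    (κ₁ κ₂ : ℝ → ℝ)
    (hnat : ∀ s ∈ I, deriv t s = (η * κ₁ s) • n₁ s + κ₂ s • b)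
    :
    (∃ c₁ c₂ c₃ c₄ : ℝ, ∀ s ∈ I,
        x s ^ 2 - y s ^ 2 + 2 * c₁ * x s + 2 * c₂ * y s + 2 * c₃ * z s + c₄ = 0) ↔
      (∃ a₁ a₂ : ℝ, ∀ s ∈ I, a₁ * κ₁ s + a₂ * κ₂ s = 1) := by
  obtain ⟨l, r, rfl⟩ := hI
  have hε2 : ε ^ 2 = 1 := by rcases hε with rfl | rfl <;> norm_num
  have hα_fst : x = fun s => (α s).1 := funext fun s => by rw [hcomp]
  have hα_snd : y = fun s => (α s).2.1 := funext fun s => by rw [hcomp]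
  have hα_thd : z = fun s => (α s).2.2 := funext fun s => by rw [hcomp]
  have hxC : ContDiff ℝ 4 x := hα_fst ▸ hα.fst
  have hyC : ContDiff ℝ 4 y := hα_snd ▸ hα.snd.fst
  have hzC : ContDiff ℝ 4 z := hα_thd ▸ hα.snd.snd
  have first : ∀ {f : ℝ → ℝ}, ContDiff ℝ 4 f → ∀ s, HasDerivAt f (deriv f s) s :=
    fun hf s => (hf.differentiable (by norm_num) s).hasDerivAt
  have second : ∀ {f : ℝ → ℝ}, ContDiff ℝ 4 f →
      ∀ s, HasDerivAt (deriv f) (deriv (deriv f) s) s := fun hf s =>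
    ((ContDiff.deriv' (n := 3) hf).differentiable (by norm_num) s).hasDerivAt
  have ht_eq : t = fun s => (deriv x s, deriv y s, deriv z s) := funext fun s => by
    rw [ht, funext hcomp]
    exact ((first hxC s).prodMk ((first hyC s).prodMk (first hzC s))).deriv
  have ht' : ∀ s, deriv t s = (deriv (deriv x) s, deriv (deriv y) s, deriv (deriv z) s) :=
    fun s => by
      rw [ht_eq]
      exact ((second hxC s).prodMk ((second hyC s).prodMk (second hzC s))).deriv
  have hn₁_top : ∀ s ∈ Set.Ioo l r, (n₁ s).1 = ε * deriv y s ∧ (n₁ s).2.1 = ε * deriv x s := by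
    intro s hs
    have hκ : η * κ s
        = deriv x s * deriv (deriv y) s - deriv (deriv x) s * deriv y s := by
      rw [hη, hκdef]; linear_combination
        (deriv x s * deriv (deriv y) s - deriv (deriv x) s * deriv y s) * hε2
    have hdet' : deriv x s * (n₁ s).2.1 - deriv y s * (n₁ s).1 = 1 := by
      have h := hdet s hs
      rw [hn, ht', hκ, ht_eq, hb] at h
      simp only [det3, Prod.smul_mk, smul_eq_mul] at h
      have hinv := inv_mul_cancel₀ (hadm s hs)
      linear_combination h + hinv
    have hort := hn₁t s hs
    rw [ht_eq] at hort
    simp only [innerZP] at hort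
    have hu := hunit s hs
    constructor
    · linear_combination ε * (deriv x s * hort + deriv y s * hdet') - (n₁ s).1 * hε2
        - ε * (n₁ s).1 * hu
    · linear_combination ε * (deriv y s * hort + deriv x s * hdet') - (n₁ s).2.1 * hε2
        - ε * (n₁ s).2.1 * hu
  have hnat' : ∀ s ∈ Set.Ioo l r, deriv (deriv x) s = -κ₁ s * deriv y s ∧
      deriv (deriv y) s = -κ₁ s * deriv x s ∧
      deriv (deriv z) s = -ε * κ₁ s * (n₁ s).2.2 + κ₂ s := by
    intro s hs
    have h := hnat s hs
    obtain ⟨h1, h2⟩ := hn₁_top s hs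
    rw [ht', hb, hη] at h
    simp only [Prod.ext_iff, Prod.fst_add, Prod.snd_add, Prod.smul_fst, Prod.smul_snd,
      smul_eq_mul, mul_zero, mul_one, add_zero] at h
    rw [h1, h2] at h
    obtain ⟨hx2, hy2, hz2⟩ := h
    exact ⟨by linear_combination hx2 - κ₁ s * deriv y s * hε2,
      by linear_combination hy2 - κ₁ s * deriv x s * hε2, by linear_combination hz2⟩
  refine sphere_iff_line_of_natural_equations (w := fun s => (n₁ s).2.2) hε2
    (fun s _ => first hxC s) (fun s _ => first hyC s) (fun s _ => first hzC s) hunit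
    (fun s hs => (second hxC s).congr_deriv (hnat' s hs).1)
    (fun s hs => (second hyC s).congr_deriv (hnat' s hs).2.1)
    (fun s hs => (second hzC s).congr_deriv (hnat' s hs).2.2) fun s hs => ?_
  obtain ⟨μ, hμ⟩ := hRM s hs
  have hd : HasDerivAt n₁ (μ • t s) s := hμ ▸ (hn₁d s hs).hasDerivAt
  rw [ht_eq] at hd
  have hd1 : HasDerivAt (fun s => (n₁ s).1) (μ * deriv x s) s := hd.fst
  have hd2 : HasDerivAt (fun s => (n₁ s).2.1) (μ * deriv y s) s := hd.snd.fst
  have hd3 : HasDerivAt (fun s => (n₁ s).2.2) (μ * deriv z s) s := hd.snd.snd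
  have h1 := hd1.unique_of_eqOn isOpen_Ioo (fun q hq => (hn₁_top q hq).1) hs
    ((second hyC s).const_mul ε)
  have h2 := hd2.unique_of_eqOn isOpen_Ioo (fun q hq => (hn₁_top q hq).2) hs
    ((second hxC s).const_mul ε)
  rw [(hnat' s hs).2.1] at h1
  rw [(hnat' s hs).1] at h2
  have hu := hunit s hs
  have hμ' : μ = -ε * κ₁ s := by
    linear_combination ε * (deriv x s * h1 - deriv y s * h2) - (μ + ε * κ₁ s) * (hε2 + ε * hu)
  exact hd3.congr_deriv (by rw [hμ'])
end
end
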